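/- Let Γ be a tree on a finite vertex set of cardinality n ≥ 3. Then there exists a bijective labelling of the vertices of Γ by {1, …, n} such that {1,2} and {2,3} are edges of Γ, and for every simple (non-recurring) path i_0 = 1, i_1, …, i_k in Γ whose endpoint i_k is a leaf of Γ, the labels satisfy i_0 < i_1 < ⋯ < i_k. -/

import Mathlib

namespace SimpleGraph

variable {V : Type*} {Γ : SimpleGraph V}

/-- In an acyclic graph every path is a geodesic. -/
lemma IsAcyclic.length_eq_dist (h : Γ.IsAcyclic) {u v : V} {p : Γ.Walk u v} (hp : p.IsPath) :
    p.length = Γ.dist u v := by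
  obtain ⟨q, hq, hlen⟩ := p.reachable.exists_path_of_dist
  have hpq : p = q := congrArg Subtype.val
    ((h.subsingleton_path u v).elim ⟨p, hp⟩ ⟨q, hq⟩)
  rw [hpq, hlen]

/-- Two vertices of an acyclic graph have at most one common neighbour. -/
lemma IsAcyclic.common_neighbor_unique (h : Γ.IsAcyclic) {u v x y : V} (huv : u ≠ v)
    (hux : Γ.Adj u x) (hxv : Γ.Adj x v) (huy : Γ.Adj u y) (hyv : Γ.Adj y v) : x = y := by
  have hpath : ∀ {z} (huz : Γ.Adj u z) (hzv : Γ.Adj z v),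
      (Walk.cons huz (Walk.cons hzv Walk.nil)).IsPath := by
    intro z huz hzv
    simp [Walk.cons_isPath_iff, huz.ne, hzv.ne, huv]
  have heq := congrArg (fun p : Γ.Path u v => p.1.getVert 1)
    ((h.subsingleton_path u v).elim ⟨_, hpath hux hxv⟩ ⟨_, hpath huy hyv⟩)
  simpa using heq

/-- Along a path in an acyclic graph, the distance from the starting vertex is the index. -/
lemma IsAcyclic.dist_getVert (h : Γ.IsAcyclic) {u v : V} {p : Γ.Walk u v} (hp : p.IsPath)
    {i : ℕ} (hi : i ≤ p.length) : Γ.dist u (p.getVert i) = i := by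
  rw [← h.length_eq_dist (hp.take i), Walk.take_length, min_eq_left hi]

/-- A connected graph with at least three vertices contains a path with three vertices. -/
lemma Connected.exists_adj_adj_ne [Fintype V] (h : Γ.Connected) (hcard : 3 ≤ Fintype.card V) :
    ∃ r a b, Γ.Adj r a ∧ Γ.Adj a b ∧ r ≠ b := by
  classical
  have : Nontrivial V := Fintype.one_lt_card_iff_nontrivial.mp (by omega)
  obtain ⟨r⟩ := h.nonempty
  obtain ⟨s, hrs⟩ := h.preconnected.exists_adj_of_nontrivial r
  obtain ⟨t, ht⟩ : ∃ t, t ∉ ({r, s} : Finset V) := by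
    by_contra! hall
    have := Finset.card_le_card (fun x _ => hall x : Finset.univ ⊆ ({r, s} : Finset V))
    have := Finset.card_le_two (a := r) (b := s)
    rw [Finset.card_univ] at *
    omega
  obtain ⟨p⟩ := h.preconnected r t
  obtain ⟨d, -, hd, hd'⟩ := p.exists_boundary_dart {r, s} (by simp) (by simpa using ht)
  simp only [Set.mem_insert_iff, Set.mem_singleton_iff, not_or] at hd hd'
  have hadj := d.adj
  rcases hd with hd | hd <;> rw [hd] at hadj
  · exact ⟨s, r, d.snd, hrs.symm, hadj, Ne.symm hd'.2⟩
  · exact ⟨r, s, d.snd, hrs, hadj, Ne.symm hd'.1⟩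

end SimpleGraph

/-- A finite type can be enumerated so that a given function is monotone. -/
lemma Fintype.exists_equiv_fin_monotone {V α : Type*} [Fintype V] [LinearOrder α] {n : ℕ}
    (hcard : Fintype.card V = n) (f : V → α) : ∃ e : V ≃ Fin n, Monotone (f ∘ e.symm) := by
  let g := Fintype.equivFinOfCardEq hcard
  exact ⟨g.trans (Tuple.sort (f ∘ g.symm)).symm, Tuple.monotone_sort (f ∘ g.symm)⟩

open Classical in
/-- A rank on the vertices: `0`, `1`, `2` at `r`, `a`, `b`, and the distance from `r` shifted
by `2` elsewhere. -/
noncomputable def SimpleGraph.rootedRank {V : Type*} (Γ : SimpleGraph V) (r a b v : V) : ℕ :=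
  if v = r then 0 else if v = a then 1 else if v = b then 2 else Γ.dist r v + 2

/-- In an acyclic graph, the rank increases along the edges that lead away from `r`. -/
lemma SimpleGraph.IsAcyclic.rootedRank_lt {V : Type*} {Γ : SimpleGraph V} (h : Γ.IsAcyclic)
    {r a b u w : V} (hra : Γ.Adj r a) (hab : Γ.Adj a b) (hrb : r ≠ b) (huw : Γ.Adj u w)
    (hru : Γ.Reachable r u) (hdist : Γ.dist r w = Γ.dist r u + 1) :
    Γ.rootedRank r a b u < Γ.rootedRank r a b w := by
  have hwr : w ≠ r := by
    rintro rfl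
    simp at hdist
  by_cases hwa : w = a
  · subst hwa
    have : Γ.dist r u = 0 := by
      have := dist_eq_one_iff_adj.mpr hra
      omega
    have := hru.dist_eq_zero_iff.mp this
    simp [rootedRank, ← this, hra.ne']
  by_cases hwb : w = b
  · subst hwb
    have hrw : (Walk.cons hra (Walk.cons hab Walk.nil)).IsPath := by
      simp [Walk.cons_isPath_iff, hra.ne, hab.ne, hrb]
    have h2 : 2 = Γ.dist r w := h.length_eq_dist hrw
    have hur : u = a :=
      h.common_neighbor_unique hrb (dist_eq_one_iff_adj.mp (by omega)) huw hra hab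
    simp [rootedRank, hwr, hwa, hur, hra.ne']
  · simp only [rootedRank, hwr, hwa, hwb, if_false]
    split_ifs <;> omega

/-- **Labelling lemma.** Let `Γ` be a tree on a finite vertex set of cardinality `n ≥ 3`.
Then there is a bijective labelling of the vertices by `Fin n` (thought of as `{1, …, n}`)
such that the vertices labelled `1,2` and `2,3` are joined by edges of `Γ`, and along every
simple path in `Γ` from the vertex labelled `1` to a leaf of `Γ`, the labels strictly
increase. -/
theorem labelling_lemma {V : Type*} [Fintype V] {n : ℕ} (hn : 3 ≤ n)
    (hcard : Fintype.card V = n) (Γ : SimpleGraph V)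
    (hconn : Γ.Connected) (hacyclic : Γ.IsAcyclic) :
    ∃ e : V ≃ Fin n,
      Γ.Adj (e.symm ⟨0, by omega⟩) (e.symm ⟨1, by omega⟩) ∧
      Γ.Adj (e.symm ⟨1, by omega⟩) (e.symm ⟨2, by omega⟩) ∧
      ∀ (v : V) (p : Γ.Walk (e.symm ⟨0, by omega⟩) v),
        p.IsPath → (∃! w : V, Γ.Adj v w) → (p.support.map e).Chain' (· < ·) := by
  obtain ⟨r, a, b, hra, hab, hrb⟩ := hconn.exists_adj_adj_ne (hcard ▸ hn)
  obtain ⟨e, he⟩ := Fintype.exists_equiv_fin_monotone hcard (Γ.rootedRank r a b)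
  have hle : ∀ i v, i ≤ e v → Γ.rootedRank r a b (e.symm i) ≤ Γ.rootedRank r a b v := by
    intro i v hi
    simpa using he hi
  have hlt : ∀ u w, Γ.rootedRank r a b u < Γ.rootedRank r a b w → e u < e w := by
    intro u w huw
    by_contra! hwu
    have := hle (e w) u hwu
    simp only [Equiv.symm_apply_apply] at this
    omega
  have hcases : ∀ v, v = r ∨ v = a ∨ v = b ∨ 2 < Γ.rootedRank r a b v := by
    intro v
    by_contra! ⟨hvr, hva, hvb, hv⟩
    have := (hconn.preconnected r v).pos_dist_of_ne hvr.symm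
    simp only [SimpleGraph.rootedRank, hvr, hva, hvb, if_false] at hv
    omega
  have hr : Γ.rootedRank r a b r = 0 := by simp [SimpleGraph.rootedRank]
  have ha : Γ.rootedRank r a b a = 1 := by simp [SimpleGraph.rootedRank, hra.ne']
  have hb : Γ.rootedRank r a b b = 2 := by simp [SimpleGraph.rootedRank, hrb.symm, hab.ne']
  have hea : e r < e a := hlt _ _ (by omega)
  have heb : e a < e b := hlt _ _ (by omega)
  rw [Fin.lt_def] at hea heb
  have h0 : e.symm ⟨0, by omega⟩ = r := by
    have := hle ⟨0, by omega⟩ r (Fin.mk_le_of_le_val (by omega))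
    have := hcases (e.symm ⟨0, by omega⟩)
    grind
  have her : (e r : ℕ) = 0 := by simp [← h0]
  have h1 : e.symm ⟨1, by omega⟩ = a := by
    have := hle ⟨1, by omega⟩ a (Fin.mk_le_of_le_val (by omega))
    have hne : e.symm ⟨1, by omega⟩ ≠ r := by simp [← h0]
    have := hcases (e.symm ⟨1, by omega⟩)
    grind
  have h2 : e.symm ⟨2, by omega⟩ = b := by
    have := hle ⟨2, by omega⟩ b (Fin.mk_le_of_le_val (by omega))
    have hne : e.symm ⟨2, by omega⟩ ≠ r := by simp [← h0]
    have hne' : e.symm ⟨2, by omega⟩ ≠ a := by simp [← h1]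
    have := hcases (e.symm ⟨2, by omega⟩)
    grind
  refine ⟨e, ?_⟩
  rw [h0, h1, h2]
  refine ⟨hra, hab, fun v p hp _ => ?_⟩
  refine List.isChain_iff_getElem.mpr fun i hi => ?_
  have hi' : i < p.length := by simpa using hi
  simp only [List.getElem_map, SimpleGraph.Walk.support_getElem_eq_getVert]
  refine hlt _ _ (hacyclic.rootedRank_lt hra hab hrb (p.adj_getVert_succ hi')
    (hconn.preconnected _ _) ?_)
  rw [hacyclic.dist_getVert hp hi', hacyclic.dist_getVert hp hi'.le]
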